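/- Let (Γ; ≤₁, …, ≤ₙ) be a homogeneous n-dimensional permutation structure with lattice Λ of ∅-definable equivalence relations, and let Λ₀ be the set of meet-irreducible elements of Λ other than the equality relation ⊥ and the trivial relation ⊤. If ℓ is the least cardinality of a family 𝒞 of chains of Λ (subsets of Λ totally ordered by refinement) whose union contains Λ₀, then 2ℓ ≤ n. -/

import Mathlib

/-- An `n`-dimensional permutation structure: a set `Γ` equipped with `n` linear orders. -/
structure PermStruct (n : ℕ) (Γ : Type*) where
  le : Fin n → Γ → Γ → Prop
  total : ∀ i x y, le i x y ∨ le i y x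
  antisymm : ∀ i x y, le i x y → le i y x → x = y
  trans : ∀ i x y z, le i x y → le i y z → le i x z

namespace PermStruct

variable {n : ℕ} {Γ : Type*} (S : PermStruct n Γ)

/-- An automorphism of the permutation structure: a bijection of `Γ` preserving each order. -/
def IsAuto (σ : Γ ≃ Γ) : Prop :=
  ∀ i x y, S.le i x y ↔ S.le i (σ x) (σ y)

/-- Homogeneity: every isomorphism between finite substructures (i.e. every bijection between
finite subsets preserving each order) extends to an automorphism. -/
def Homogeneous : Prop :=
  ∀ (A : Finset Γ) (f : Γ → Γ), Set.InjOn f A →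
    (∀ i, ∀ x ∈ A, ∀ y ∈ A, (S.le i x y ↔ S.le i (f x) (f y))) →
    ∃ σ : Γ ≃ Γ, S.IsAuto σ ∧ ∀ a ∈ A, σ a = f a

/-- A binary relation is ∅-definable iff it is invariant under all automorphisms. -/
def Definable (R : Γ → Γ → Prop) : Prop :=
  ∀ σ : Γ ≃ Γ, S.IsAuto σ → ∀ x y, R x y ↔ R (σ x) (σ y)

/-- `E` is `≤ᵢ`-convex: every `E`-class is an interval with respect to `≤ᵢ`. -/
def Convex (i : Fin n) (E : Γ → Γ → Prop) : Prop :=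
  ∀ x y z, S.le i x y → S.le i y z → E x z → E x y

end PermStruct

/-- Dilworth's theorem: a finite set in a partial order has an antichain and a partition into
chains of the same cardinality. -/
theorem Finset.exists_antichain_and_chain_cover {α : Type*} [PartialOrder α] (s : Finset α) :
    ∃ k : ℕ, (∃ A ⊆ s, IsAntichain (· ≤ ·) (A : Set α) ∧ A.card = k) ∧
      ∃ f : α → ℕ, (∀ x ∈ s, f x < k) ∧ ∀ x ∈ s, ∀ y ∈ s, f x = f y → x ≤ y ∨ y ≤ x := by
  classical
  induction s using Finset.strongInduction with
  | H s ih =>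
    rcases s.eq_empty_or_nonempty with rfl | hs
    · exact ⟨0, ⟨∅, by simp, by simp, by simp⟩, fun _ => 0, by simp, by simp⟩
    obtain ⟨a, ha⟩ := s.exists_maximal hs
    obtain ⟨k, ⟨A₀, hA₀, hA₀', hA₀k⟩, f, hfk, hf⟩ := ih (s.erase a) (Finset.erase_ssubset ha.1)
    have hinj : ∀ B ⊆ s.erase a, IsAntichain (· ≤ ·) (B : Set α) → Set.InjOn f B := by
      intro B hB hB' x hx y hy hxy
      rcases hf x (hB hx) y (hB hy) hxy with h | h
      · exact hB'.eq hx hy h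
      · exact (hB'.eq hy hx h).symm
    have hmap : ∀ B ⊆ s.erase a, B.image f ⊆ Finset.range k := by
      intro B hB
      simp only [Finset.image_subset_iff, Finset.mem_range]
      exact fun x hx => hfk x (hB hx)
    have hcard : ∀ B ⊆ s.erase a, IsAntichain (· ≤ ·) (B : Set α) → B.card ≤ k := by
      intro B hB hB'
      rw [← Finset.card_image_of_injOn (hinj B hB hB')]
      simpa using Finset.card_le_card (hmap B hB)
    have hsurj : ∀ B ⊆ s.erase a, IsAntichain (· ≤ ·) (B : Set α) → B.card = k →
        ∀ c < k, ∃ x ∈ B, f x = c := by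
      intro B hB hB' hBk c hc
      have h_eq : B.image f = Finset.range k :=
        Finset.eq_of_subset_of_card_le (hmap B hB)
          (by rw [Finset.card_image_of_injOn (hinj B hB hB'), hBk, Finset.card_range])
      simpa using (h_eq ▸ Finset.mem_range.2 hc : c ∈ B.image f)
    -- the top element of each chain lying in a maximum antichain
    have htop : ∀ c : Fin k, ∃ x ∈ s.erase a, f x = c ∧
        (∃ B ⊆ s.erase a, IsAntichain (· ≤ ·) (B : Set α) ∧ B.card = k ∧ x ∈ B) ∧
        ∀ B ⊆ s.erase a, IsAntichain (· ≤ ·) (B : Set α) → B.card = k →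
          ∀ y ∈ B, f y = c → y ≤ x := by
      intro c
      let Q := (s.erase a).filter fun x => f x = c ∧
        ∃ B ⊆ s.erase a, IsAntichain (· ≤ ·) (B : Set α) ∧ B.card = k ∧ x ∈ B
      have hQ : Q.Nonempty := by
        obtain ⟨x, hx, hxc⟩ := hsurj A₀ hA₀ hA₀' hA₀k c c.2
        exact ⟨x, Finset.mem_filter.2 ⟨hA₀ hx, hxc, A₀, hA₀, hA₀', hA₀k, hx⟩⟩
      obtain ⟨x, hx⟩ := Q.exists_maximal hQ
      obtain ⟨hxs, hxc, hxB⟩ := Finset.mem_filter.1 hx.1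
      refine ⟨x, hxs, hxc, hxB, fun B hB hB' hBk y hy hyc => ?_⟩
      rcases hf x hxs y (hB hy) (hxc.trans hyc.symm) with h | h
      · exact hx.2 (Finset.mem_filter.2 ⟨hB hy, hyc, B, hB, hB', hBk, hy⟩) h
      · exact h
    choose x hxs hxc hxB hxmax using htop
    have hx_anti : ∀ c d, x c ≤ x d → c = d := by
      intro c d hcd
      obtain ⟨B, hB, hB', hBk, hxd⟩ := hxB d
      obtain ⟨y, hy, hyc⟩ := hsurj B hB hB' hBk c c.2
      have h_eq := hB'.eq hy hxd ((hxmax c B hB hB' hBk y hy hyc).trans hcd)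
      exact Fin.ext (by rw [← hyc, h_eq, hxc])
    let A := Finset.univ.image x
    have hAs : A ⊆ s.erase a := by
      simpa [A, Finset.subset_iff] using hxs
    have hA : IsAntichain (· ≤ ·) (A : Set α) := by
      intro y hy z hz hne hle
      simp only [A, Finset.coe_image, Finset.coe_univ, Set.image_univ, Set.mem_range] at hy hz
      obtain ⟨c, rfl⟩ := hy
      obtain ⟨d, rfl⟩ := hz
      exact hne (congrArg x (hx_anti c d hle))
    have hAk : A.card = k := by
      rw [Finset.card_image_of_injective _ fun c d h => hx_anti c d h.le, Finset.card_fin]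
    by_cases hinc : ∃ c, x c ≤ a
    · obtain ⟨c, hca⟩ := hinc
      let K := s.filter fun z => z = a ∨ (f z = c ∧ z ≤ x c)
      have hK : ∀ y ∈ K, ∀ z ∈ K, y ≤ z ∨ z ≤ y := by
        intro y hy z hz
        obtain ⟨hys, hy⟩ := Finset.mem_filter.1 hy
        obtain ⟨hzs, hz⟩ := Finset.mem_filter.1 hz
        by_cases hya : y = a
        · rcases hz with rfl | hz
          · exact Or.inl hya.le
          · exact Or.inr (hya ▸ hz.2.trans hca)
        by_cases hza : z = a
        · exact Or.inl (hza ▸ (hy.resolve_left hya).2.trans hca)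
        exact hf y (Finset.mem_erase.2 ⟨hya, hys⟩) z (Finset.mem_erase.2 ⟨hza, hzs⟩)
          ((hy.resolve_left hya).1.trans (hz.resolve_left hza).1.symm)
      have haK : a ∈ K := Finset.mem_filter.2 ⟨ha.1, Or.inl rfl⟩
      have hsub : s \ K ⊆ s.erase a := by
        intro z hz
        obtain ⟨hzs, hzK⟩ := Finset.mem_sdiff.1 hz
        exact Finset.mem_erase.2 ⟨fun h => hzK (h ▸ haK), hzs⟩
      obtain ⟨k', ⟨A', hA's, hA', hA'k⟩, f', hf'k, hf'⟩ := ih (s \ K)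
        (Finset.sdiff_ssubset (Finset.filter_subset _ _) ⟨a, haK⟩)
      have hk' : k' < k := by
        refine lt_of_le_of_ne (hA'k ▸ hcard A' (hA's.trans hsub) hA') fun h => ?_
        have hA'k' := hA'k.trans h
        obtain ⟨y, hy, hyc⟩ := hsurj A' (hA's.trans hsub) hA' hA'k' c c.2
        have hyx := hxmax c A' (hA's.trans hsub) hA' hA'k' y hy hyc
        obtain ⟨hys, hyK⟩ := Finset.mem_sdiff.1 (hA's hy)
        exact hyK (Finset.mem_filter.2 ⟨hys, Or.inr ⟨hyc, hyx⟩⟩)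
      refine ⟨k, ⟨A, hAs.trans (Finset.erase_subset _ _), hA, hAk⟩,
        fun z => if z ∈ K then k' else f' z, fun z hz => ?_, fun y hy z hz hyz => ?_⟩
      · by_cases hzK : z ∈ K
        · simpa [hzK] using hk'
        · simpa [hzK] using (hf'k z (Finset.mem_sdiff.2 ⟨hz, hzK⟩)).trans hk'
      · by_cases hyK : y ∈ K <;> by_cases hzK : z ∈ K <;>
          simp only [hyK, hzK, if_true, if_false] at hyz
        · exact hK y hyK z hzK
        · exact absurd hyz.symm (hf'k z (Finset.mem_sdiff.2 ⟨hz, hzK⟩)).ne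
        · exact absurd hyz (hf'k y (Finset.mem_sdiff.2 ⟨hy, hyK⟩)).ne
        · exact hf' y (Finset.mem_sdiff.2 ⟨hy, hyK⟩) z (Finset.mem_sdiff.2 ⟨hz, hzK⟩) hyz
    · push Not at hinc
      have haA : a ∉ A := fun h => Finset.notMem_erase a s (hAs h)
      refine ⟨k + 1, ⟨insert a A, ?_, ?_, ?_⟩, fun z => if z = a then k else f z,
        fun z hz => ?_, fun y hy z hz hyz => ?_⟩
      · exact Finset.insert_subset ha.1 (hAs.trans (Finset.erase_subset _ _))
      · rw [Finset.coe_insert]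
        refine hA.insert (fun b hb _ h => ?_) (fun b hb hne h => ?_)
        all_goals
          have hbs := hAs hb
          obtain ⟨c, -, rfl⟩ := Finset.mem_image.1 hb
        · exact hinc c h
        · exact hinc c (ha.2 (Finset.mem_of_mem_erase hbs) h)
      · rw [Finset.card_insert_of_notMem haA, hAk]
      · by_cases hza : z = a
        · simp [hza]
        · simpa [hza] using (hfk z (Finset.mem_erase.2 ⟨hza, hz⟩)).trans k.lt_succ_self
      · by_cases hya : y = a <;> by_cases hza : z = a <;>
          simp only [hya, hza, if_true, if_false] at hyz
        · exact Or.inl (hya.trans hza.symm).le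
        · exact absurd hyz.symm (hfk z (Finset.mem_erase.2 ⟨hza, hz⟩)).ne
        · exact absurd hyz (hfk y (Finset.mem_erase.2 ⟨hya, hy⟩)).ne
        · exact hf y (Finset.mem_erase.2 ⟨hya, hy⟩) z (Finset.mem_erase.2 ⟨hza, hz⟩) hyz

namespace PermStruct

variable {n : ℕ} {Γ : Type*} {S : PermStruct n Γ}

theorem IsAuto.symm {σ : Γ ≃ Γ} (h : S.IsAuto σ) : S.IsAuto σ.symm := by
  intro i x y
  simpa using (h i (σ.symm x) (σ.symm y)).symm

/-! ### Closure properties of definable relations -/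

theorem Definable.and {P Q : Γ → Γ → Prop} (hP : S.Definable P) (hQ : S.Definable Q) :
    S.Definable fun x y => P x y ∧ Q x y :=
  fun σ h x y => and_congr (hP σ h x y) (hQ σ h x y)

theorem Definable.not {P : Γ → Γ → Prop} (hP : S.Definable P) :
    S.Definable fun x y => ¬ P x y :=
  fun σ h x y => not_congr (hP σ h x y)

theorem Definable.swap {P : Γ → Γ → Prop} (hP : S.Definable P) :
    S.Definable fun x y => P y x :=
  fun σ h x y => hP σ h y x

theorem Definable.exists {P Q : Γ → Γ → Prop} (hP : S.Definable P) (hQ : S.Definable Q) :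
    S.Definable fun x y => ∃ z, P x z ∧ Q y z := by
  intro σ h x y
  beta_reduce
  rw [σ.surjective.exists (p := fun z => P (σ x) z ∧ Q (σ y) z)]
  exact exists_congr fun z => and_congr (hP σ h x z) (hQ σ h y z)

theorem Definable.forall {P Q : Γ → Γ → Prop} (hP : S.Definable P) (hQ : S.Definable Q) :
    S.Definable fun x y => ∀ z, P x z → Q y z := by
  intro σ h x y
  beta_reduce
  rw [σ.surjective.forall (p := fun z => P (σ x) z → Q (σ y) z)]
  exact forall_congr' fun z => imp_congr (hP σ h x z) (hQ σ h y z)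

/-! ### Types of pairs -/

variable (S) in
/-- The quantifier-free type of a pair of points. -/
def pairType (x y : Γ) : Fin n → Prop × Prop := fun i => (S.le i x y, S.le i y x)

theorem pairType_eq_iff {x y x' y' : Γ} : S.pairType x y = S.pairType x' y' ↔
    ∀ i, (S.le i x y ↔ S.le i x' y') ∧ (S.le i y x ↔ S.le i y' x') := by
  simp [pairType, funext_iff]

theorem IsAuto.pairType_eq {σ : Γ ≃ Γ} (h : S.IsAuto σ) (x y : Γ) :
    S.pairType (σ x) (σ y) = S.pairType x y :=
  pairType_eq_iff.2 fun i => ⟨(h i x y).symm, (h i y x).symm⟩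

theorem le_refl (S : PermStruct n Γ) (i : Fin n) (x : Γ) : S.le i x x :=
  (S.total i x x).elim id id

theorem pairType_swap {x y x' y' : Γ} (h : S.pairType x y = S.pairType x' y') :
    S.pairType y x = S.pairType y' x' :=
  pairType_eq_iff.2 fun i => (pairType_eq_iff.1 h i).symm

theorem pairType_self (x y : Γ) : S.pairType x x = S.pairType y y :=
  pairType_eq_iff.2 fun i => by simp [S.le_refl]

theorem eq_iff_of_pairType_eq [Nonempty (Fin n)] {x y x' y' : Γ}
    (h : S.pairType x y = S.pairType x' y') : x = y ↔ x' = y' := by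
  obtain ⟨i⟩ := ‹Nonempty (Fin n)›
  obtain ⟨h₁, h₂⟩ := pairType_eq_iff.1 h i
  constructor
  · rintro rfl
    exact S.antisymm i _ _ (h₁.1 (S.le_refl i _)) (h₂.1 (S.le_refl i _))
  · rintro rfl
    exact S.antisymm i _ _ (h₁.2 (S.le_refl i _)) (h₂.2 (S.le_refl i _))

/-- Every type of pairs is a transitive relation. -/
theorem pairType_trans [Nonempty (Fin n)] {x y z : Γ}
    (h : S.pairType x y = S.pairType y z) : S.pairType x z = S.pairType x y := by
  have h_eq := eq_iff_of_pairType_eq h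
  by_cases hxy : x = y
  · rw [← h_eq.1 hxy]
  refine pairType_eq_iff.2 fun i => ?_
  have h_i := pairType_eq_iff.1 h i
  have := S.total i x y
  have := S.antisymm i x y
  have := S.trans i x y z
  have := S.trans i z y x
  have := S.trans i z x y
  have := S.trans i y x z
  have := S.trans i y z x
  have := S.trans i x z y
  grind

/-! ### Consequences of homogeneity -/

theorem Homogeneous.exists_tuple [Nonempty (Fin n)] (hhom : S.Homogeneous) {k : ℕ}
    (a b : Fin k → Γ) (h : ∀ i j, S.pairType (a i) (a j) = S.pairType (b i) (b j)) :
    ∃ σ : Γ ≃ Γ, S.IsAuto σ ∧ ∀ i, σ (a i) = b i := by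
  classical
  let f : Γ → Γ := fun z => if hz : ∃ i, a i = z then b hz.choose else z
  have hf : ∀ i, f (a i) = b i := by
    intro i
    have hz : ∃ j, a j = a i := ⟨i, rfl⟩
    simp only [f, dif_pos hz]
    exact (eq_iff_of_pairType_eq (h _ _)).1 hz.choose_spec
  obtain ⟨σ, hσ, h_eq⟩ := hhom (Finset.univ.image a) f (by
      intro x hx y hy hxy
      simp only [Finset.coe_image, Finset.coe_univ, Set.image_univ, Set.mem_range] at hx hy
      obtain ⟨i, rfl⟩ := hx
      obtain ⟨j, rfl⟩ := hy
      rw [hf, hf] at hxy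
      exact (eq_iff_of_pairType_eq (h _ _)).2 hxy) (by
      intro l x hx y hy
      simp only [Finset.mem_image, Finset.mem_univ, true_and] at hx hy
      obtain ⟨i, rfl⟩ := hx
      obtain ⟨j, rfl⟩ := hy
      rw [hf, hf]
      exact (pairType_eq_iff.1 (h i j) l).1)
  exact ⟨σ, hσ, fun i => (h_eq _ (by simp)).trans (hf i)⟩

theorem Homogeneous.exists_one [Nonempty (Fin n)] (hhom : S.Homogeneous) (x y : Γ) :
    ∃ σ : Γ ≃ Γ, S.IsAuto σ ∧ σ x = y := by
  obtain ⟨σ, hσ, h⟩ := hhom.exists_tuple ![x] ![y] (by simp [pairType_self x y])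
  exact ⟨σ, hσ, h 0⟩

theorem Homogeneous.exists_two [Nonempty (Fin n)] (hhom : S.Homogeneous) {x y x' y' : Γ}
    (h : S.pairType x y = S.pairType x' y') :
    ∃ σ : Γ ≃ Γ, S.IsAuto σ ∧ σ x = x' ∧ σ y = y' := by
  obtain ⟨σ, hσ, h⟩ := hhom.exists_tuple ![x, y] ![x', y'] (by
    simp [Fin.forall_fin_succ, pairType_self x x', pairType_self y y', h, pairType_swap h])
  exact ⟨σ, hσ, h 0, h 1⟩

theorem Homogeneous.exists_three [Nonempty (Fin n)] (hhom : S.Homogeneous) {x y z x' y' z' : Γ}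
    (hxy : S.pairType x y = S.pairType x' y') (hyz : S.pairType y z = S.pairType y' z')
    (hxz : S.pairType x z = S.pairType x' z') :
    ∃ σ : Γ ≃ Γ, S.IsAuto σ ∧ σ x = x' ∧ σ y = y' ∧ σ z = z' := by
  obtain ⟨σ, hσ, h⟩ := hhom.exists_tuple ![x, y, z] ![x', y', z'] (by
    simp [Fin.forall_fin_succ, pairType_self x x', pairType_self y y', pairType_self z z',
      hxy, hyz, hxz, pairType_swap hxy, pairType_swap hyz, pairType_swap hxz])
  exact ⟨σ, hσ, h 0, h 1, h 2⟩

theorem Homogeneous.rel_iff [Nonempty (Fin n)] (hhom : S.Homogeneous) {R : Γ → Γ → Prop}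
    (hR : S.Definable R) {x y x' y' : Γ} (h : S.pairType x y = S.pairType x' y') :
    R x y ↔ R x' y' := by
  obtain ⟨σ, hσ, rfl, rfl⟩ := hhom.exists_two h
  exact hR σ hσ x y

theorem Homogeneous.finite_definable [Nonempty (Fin n)] (hhom : S.Homogeneous) :
    {R : Γ → Γ → Prop | S.Definable R}.Finite := by
  let φ : (Γ → Γ → Prop) → Set (Fin n → Prop × Prop) :=
    fun R => {t | ∃ x y, R x y ∧ S.pairType x y = t}
  refine Set.Finite.of_finite_image (f := φ) (Set.toFinite _) ?_
  have key : ∀ R R' : Γ → Γ → Prop, S.Definable R' → φ R = φ R' → ∀ x y, R x y → R' x y := by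
    intro R R' hR' h x y hxy
    have : S.pairType x y ∈ φ R' := h ▸ ⟨x, y, hxy, rfl⟩
    obtain ⟨x', y', h', ht⟩ := this
    exact (hhom.rel_iff hR' ht).1 h'
  intro R hR R' hR' h
  ext x y
  exact ⟨key R R' hR' h x y, key R' R hR h.symm x y⟩

/-! ### Convex equivalence relations are comparable -/

theorem Homogeneous.le_or_le_of_convex [Nonempty (Fin n)] (hhom : S.Homogeneous) {i : Fin n}
    {E F : Γ → Γ → Prop} (hE : S.Definable E) (hE' : Equivalence E) (hEi : S.Convex i E)
    (hF : S.Definable F) (hF' : Equivalence F) (hFi : S.Convex i F) :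
    (∀ x y, E x y → F x y) ∨ (∀ x y, F x y → E x y) := by
  by_contra! hcon
  obtain ⟨⟨a, a', ha, ha'⟩, b, b', hb, hb'⟩ := hcon
  have key : ∀ E F : Γ → Γ → Prop, S.Definable E → Equivalence E → S.Convex i E →
      S.Definable F → Equivalence F → S.Convex i F → ∀ u y v, E y u → ¬ F y u → F y v →
      ¬ E y v → S.le i u y → S.le i y v → False := by
    intro E F hE hE' hEi hF hF' hFi u y v hu hu' hv hv' huy hyv
    obtain ⟨σ, hσ, hσy⟩ := hhom.exists_one y u
    have h₁ : F u (σ v) := hσy ▸ (hF σ hσ y v).1 hv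
    have h₂ : ¬ E u (σ v) := hσy ▸ (hE σ hσ y v).not.1 hv'
    have h₃ : S.le i u (σ v) := hσy ▸ (hσ i y v).1 hyv
    rcases S.total i (σ v) y with h | h
    · exact h₂ (hEi u (σ v) y h₃ h (hE'.symm hu))
    · exact hu' (hF'.symm (hFi u y (σ v) huy h h₁))
  obtain ⟨σ, hσ, rfl⟩ := hhom.exists_one b a
  set v := σ b'
  set y := σ b
  have hv : F y v := (hF σ hσ _ _).1 hb
  have hv' : ¬ E y v := (hE σ hσ _ _).not.1 hb'
  rcases S.total i a' y with h₁ | h₁ <;> rcases S.total i y v with h₂ | h₂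
  · exact key E F hE hE' hEi hF hF' hFi a' y v ha ha' hv hv' h₁ h₂
  · rcases S.total i a' v with h₃ | h₃
    · exact hv' (hE'.trans ha (hEi a' v y h₃ h₂ (hE'.symm ha)))
    · exact ha' (hF'.trans hv (hFi v a' y h₃ h₁ (hF'.symm hv)))
  · rcases S.total i a' v with h₃ | h₃
    · exact ha' (hFi y a' v h₁ h₃ hv)
    · exact hv' (hEi y v a' h₂ h₃ ha)
  · exact key F E hF hF' hFi hE hE' hEi v y a' hv hv' ha ha' h₂ h₁

/-! ### Comparing suprema of classes -/

/-- The class of `x` has supremum at most that of the class of `y`, with respect to `r`. -/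
def SupLE (r E : Γ → Γ → Prop) (x y : Γ) : Prop :=
  ∀ x', E x x' → ∃ y', E y y' ∧ r x' y'

theorem SupLE.definable {r E : Γ → Γ → Prop} (hr : S.Definable r) (hE : S.Definable E) :
    S.Definable (SupLE r E) :=
  hE.forall (Q := fun y x' => ∃ y', E y y' ∧ r x' y') (hE.exists hr)

/-- A class with the same supremum as no other class is convex. -/
theorem Homogeneous.convex_of_supLE_injective [Nonempty (Fin n)] [LinearOrder Γ]
    (hhom : S.Homogeneous) (hle : S.Definable (· ≤ ·)) {E : Γ → Γ → Prop}
    (hE : S.Definable E) (hE' : Equivalence E)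
    (hinj : ∀ x y, SupLE (· ≤ ·) E x y → SupLE (· ≤ ·) E y x → E x y) :
    ∀ x y z, x ≤ y → y ≤ z → E x z → E x y := by
  set L : Γ → Γ → Prop := SupLE (· ≤ ·) E with hL
  have hLdef : S.Definable L := SupLE.definable hle hE
  have hlt : S.Definable (fun x y : Γ => x < y) := by
    simpa only [not_le] using (hle.swap).not
  have hL_trans : ∀ {x y z}, L x y → L y z → L x z := by
    intro x y z h₁ h₂ x' hx'
    obtain ⟨y', hy', h⟩ := h₁ x' hx'
    obtain ⟨z', hz', h'⟩ := h₂ y' hy'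
    exact ⟨z', hz', h.trans h'⟩
  have hL_E : ∀ {x y}, E x y → L x y := fun h x' hx' =>
    ⟨x', hE'.trans (hE'.symm h) hx', le_rfl⟩
  have hnL : ∀ {x y}, ¬ L y x → ∃ y', E y y' ∧ ∀ x', E x x' → x' < y' := by
    intro x y h
    simp only [hL, SupLE] at h
    push Not at h
    exact h
  have hL_total : ∀ {x y}, ¬ L y x → L x y := by
    intro x y h x' hx'
    obtain ⟨y', hy', h'⟩ := hnL h
    exact ⟨y', hy', (h' x' hx').le⟩
  have hnL_left : ∀ {x x' y}, E x x' → ¬ L y x → ¬ L y x' := fun h h' h'' =>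
    h' (hL_trans h'' (hL_E (hE'.symm h)))
  have hnL_right : ∀ {x y y'}, E y y' → ¬ L y x → ¬ L y' x := fun h h' h'' =>
    h' (hL_trans (hL_E h) h'')
  let T : Γ → Γ → Prop := fun a b => (a < b ∧ ∃ a', E a a' ∧ b ≤ a') ∧ ¬ L b a
  have hTdef : S.Definable T := (hlt.and (hE.exists hle)).and hLdef.swap.not
  have hT : ∀ a b, ¬ T a b := by
    intro a b hab
    have hbound : ∀ t, ∃ c, E b c ∧ ∀ y, S.pairType b y = t → T b y → y < c := by
      intro t
      by_cases hex : ∃ y, S.pairType b y = t ∧ T b y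
      · obtain ⟨y, rfl, hy⟩ := hex
        obtain ⟨σ, hσ, hσy⟩ := hhom.exists_one y b
        have hw : S.pairType (σ b) b = S.pairType b y := by
          conv_lhs => rw [← hσy]
          exact (hσ.pairType_eq b y ▸ by rw [hσy])
        have hTw : T (σ b) b := (hhom.rel_iff hTdef hw).2 hy
        obtain ⟨c, hc, hc'⟩ := hnL hTw.2
        refine ⟨c, hc, fun z hz _ => ?_⟩
        have hwz : T (σ b) z :=
          (hhom.rel_iff hTdef (pairType_trans (hw.trans hz.symm))).2 hTw
        obtain ⟨w', hw', hzw⟩ := hwz.1.2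
        exact hzw.trans_lt (hc' w' hw')
      · exact ⟨b, hE'.refl b, fun y hy hy' => (hex ⟨y, hy, hy'⟩).elim⟩
    choose c hc hc' using hbound
    obtain ⟨t₀, ht₀⟩ := Finite.exists_max c
    obtain ⟨σ, hσ, hσa⟩ := hhom.exists_one a b
    have h₁ := (hTdef σ hσ _ _).1 hab
    rw [hσa] at h₁
    have h₂ : b < c t₀ := h₁.1.1.trans ((hc' _ _ rfl h₁).trans_le (ht₀ _))
    obtain ⟨τ, hτ, hτc⟩ := hhom.exists_one a (c t₀)
    have h₃ := (hTdef τ hτ _ _).1 hab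
    rw [hτc] at h₃
    have h₄ : T b (τ b) := by
      refine ⟨⟨h₂.trans h₃.1.1, ?_⟩, hnL_left (hE'.symm (hc t₀)) h₃.2⟩
      obtain ⟨w, hw, hw'⟩ := h₃.1.2
      exact ⟨w, hE'.trans (hc t₀) hw, hw'⟩
    exact absurd ((hc' _ _ rfl h₄).trans_le (ht₀ _)) h₃.1.1.not_gt
  have hT' : ∀ {a a' b}, a < b → E a a' → b ≤ a' → L b a := fun {a a' b} h h' h'' =>
    by_contra fun hcon => hT a b ⟨⟨h, a', h', h''⟩, hcon⟩
  let N : Γ → Γ → Prop := fun x y => x < y ∧ ¬ L x y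
  have hNdef : S.Definable N := hlt.and hLdef.not
  have hN_bound : ∀ {x y}, N x y → ∃ x', E x x' ∧ y < x' := by
    intro x y h
    obtain ⟨x', hx', h'⟩ := hnL h.2
    exact ⟨x', hx', h' y (hE'.refl y)⟩
  have hN : ∀ x y, ¬ N x y := by
    intro x₀ y₀ h₀
    obtain ⟨x₁, hx₁, hyx⟩ := hN_bound h₀
    obtain ⟨α, hα, hα₀⟩ := hhom.exists_one x₀ x₁
    have h₁ : N x₁ (α y₀) := hα₀ ▸ (hNdef α hα _ _).1 h₀
    have hx₂ : E x₁ (α x₁) := by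
      have := (hE α hα _ _).1 hx₁
      rwa [hα₀] at this
    have hyx₂ : α y₀ < α x₁ := (hlt α hα _ _).1 hyx
    have h₂ : N (α x₁) (α (α y₀)) := (hNdef α hα _ _).1 h₁
    have hc : S.pairType (α y₀) (α (α y₀)) = S.pairType y₀ (α y₀) := hα.pairType_eq _ _
    have htype : S.pairType x₁ (α y₀) = S.pairType x₀ y₀ := hα₀ ▸ hα.pairType_eq x₀ y₀
    generalize α (α y₀) = y₂ at *
    generalize α x₁ = x₂ at *
    generalize α y₀ = y₁ at *
    -- an intermediate class between those of `x₁` and `y₁`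
    obtain ⟨z, hz₁, hz₂⟩ : ∃ z, S.pairType x₁ z = S.pairType x₁ y₁ ∧
        S.pairType z y₁ = S.pairType x₁ y₁ := by
      obtain ⟨β, hβ, hβx⟩ := hhom.exists_one x₁ y₁
      have h : S.pairType y₁ (β y₁) = S.pairType x₁ y₁ := by
        conv_lhs => rw [← hβx]
        rw [hβx]
        exact hβx ▸ hβ.pairType_eq x₁ y₁
      obtain ⟨γ, hγ, hγx, hγy⟩ := hhom.exists_two (pairType_trans h.symm)
      refine ⟨γ y₁, ?_, ?_⟩
      · have := hγ.pairType_eq x₁ y₁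
        rwa [hγx] at this
      · have := hγ.pairType_eq y₁ (β y₁)
        rw [hγy] at this
        exact this.trans h
    have hxz : N x₁ z := (hhom.rel_iff hNdef hz₁).2 h₁
    have hzy : N z y₁ := (hhom.rel_iff hNdef hz₂).2 h₁
    have hz_above : ∀ z', E z z' → y₀ < z' := by
      intro z' hz'
      by_contra! hcon
      have h₃ : L x₁ z' := hT' (hcon.trans_lt hyx) (hE'.symm hz') hxz.1.le
      exact hxz.2 (hL_trans h₃ (hL_E (hE'.symm hz')))
    obtain ⟨δ, hδ, hδx, hδy⟩ := hhom.exists_two hz₂.symm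
    have hz₃ : E z (δ x₂) := hδx ▸ (hE δ hδ _ _).1 hx₂
    have hz₄ : N (δ x₂) (δ y₂) := (hNdef δ hδ _ _).1 h₂
    have hz₅ : S.pairType y₁ (δ y₂) = S.pairType y₁ y₂ := by
      have := hδ.pairType_eq y₁ y₂
      rwa [hδy] at this
    obtain ⟨z', hz', hyz'⟩ := hN_bound hz₄
    have hzz' : E z z' := hE'.trans hz₃ hz'
    generalize δ y₂ = y₃ at *
    obtain ⟨η, hη, hη₀, hη₁, hη₂⟩ := hhom.exists_three (x := y₀) (y := y₁) (z := y₂)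
      (x' := y₀) (y' := y₁) (z' := y₃) rfl hz₅.symm
      ((pairType_trans hc.symm).trans (pairType_trans (hc.symm.trans hz₅.symm)).symm)
    have e₀ : η x₀ < y₀ := hη₀ ▸ (hlt η hη _ _).1 h₀.1
    have e₁ : E (η x₀) (η x₁) := (hE η hη _ _).1 hx₁
    have e₂ : E (η x₁) (η x₂) := (hE η hη _ _).1 hx₂
    have e₃ : y₁ < η x₂ := hη₁ ▸ (hlt η hη _ _).1 hyx₂
    have e₄ : η x₂ < y₃ := hη₂ ▸ (hlt η hη _ _).1 h₂.1
    have l₁ : L (η x₂) z := hT' (hzy.1.trans e₃) hzz' (e₄.le.trans hyz'.le)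
    have l₂ : L z (η x₀) := hT' (e₀.trans (hz_above z (hE'.refl z))) (hE'.trans e₁ e₂)
      (hzy.1.trans e₃).le
    have l₃ : E z (η x₀) :=
      hinj _ _ l₂ (hL_trans (hL_E (hE'.trans e₁ e₂)) l₁)
    exact absurd (hz_above _ l₃) e₀.not_gt
  intro x y z hxy hyz hxz
  rcases hxy.eq_or_lt with rfl | hxy
  · exact hE'.refl x
  refine hinj x y ?_ (hT' hxy hxz hyz)
  by_contra hcon
  exact hN x y ⟨hxy, hcon⟩

/-! ### Directed types -/

variable (S) in
/-- The `i`-th order if `b` is true, and its reverse otherwise. -/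
def signedLE (i : Fin n) (b : Bool) (x y : Γ) : Prop :=
  if b then S.le i x y else S.le i y x

theorem signedLE_refl (i : Fin n) (b : Bool) (x : Γ) : S.signedLE i b x x := by
  cases b <;> exact S.le_refl i x

theorem signedLE_total (i : Fin n) (b : Bool) (x y : Γ) :
    S.signedLE i b x y ∨ S.signedLE i b y x := by
  cases b
  · exact S.total i y x
  · exact S.total i x y

theorem signedLE_antisymm {i : Fin n} {b : Bool} {x y : Γ} (h : S.signedLE i b x y)
    (h' : S.signedLE i b y x) : x = y := by
  cases b
  · exact S.antisymm i x y h' h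
  · exact S.antisymm i x y h h'

theorem signedLE_trans {i : Fin n} {b : Bool} {x y z : Γ} (h : S.signedLE i b x y)
    (h' : S.signedLE i b y z) : S.signedLE i b x z := by
  cases b
  · exact S.trans i z y x h' h
  · exact S.trans i x y z h h'

theorem signedLE_definable (i : Fin n) (b : Bool) : S.Definable (S.signedLE i b) := by
  intro σ hσ x y
  cases b
  · exact hσ i y x
  · exact hσ i x y

theorem pairType_eq_of_signedLE {x x' y : Γ} (p : Fin n → Bool)
    (h : ∀ i, ¬ S.signedLE i (p i) y x) (h' : ∀ i, ¬ S.signedLE i (p i) y x') :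
    S.pairType x y = S.pairType x' y := by
  refine pairType_eq_iff.2 fun i => ?_
  have h₁ := h i
  have h₂ := h' i
  have h₃ := S.total i x y
  have h₄ := S.total i x' y
  cases hp : p i <;> simp only [signedLE, hp, if_true, Bool.false_eq_true, if_false] at h₁ h₂ <;>
    grind

theorem exists_signedLE_max (i : Fin n) (b : Bool) {A : Finset Γ} (hA : A.Nonempty) :
    ∃ m ∈ A, ∀ a ∈ A, S.signedLE i b a m := by
  classical
  let _ : LinearOrder Γ :=
    { le := S.signedLE i b
      le_refl := signedLE_refl i b
      le_trans := fun _ _ _ => signedLE_trans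
      le_antisymm := fun _ _ => signedLE_antisymm
      le_total := signedLE_total i b
      toDecidableLE := Classical.decRel _ }
  exact A.exists_max_image id hA

theorem Homogeneous.exists_rel_beyond [Nonempty (Fin n)] (hhom : S.Homogeneous)
    {E : Γ → Γ → Prop} (hE : S.Definable E) (hE' : Equivalence E) (hE_ne : ∃ x y, E x y ∧ x ≠ y)
    (i : Fin n) (b : Bool) (m : Γ) : ∃ v, E m v ∧ ¬ S.signedLE i b v m := by
  have key : ∀ x y, E x y → x ≠ y → S.signedLE i b x y → ∃ v, E m v ∧ ¬ S.signedLE i b v m := by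
    intro x y hxy hne hle
    obtain ⟨σ, hσ, rfl⟩ := hhom.exists_one x m
    refine ⟨σ y, (hE σ hσ _ _).1 hxy, fun h => hne ?_⟩
    exact signedLE_antisymm hle ((signedLE_definable i b σ hσ _ _).2 h)
  obtain ⟨x, y, hxy, hne⟩ := hE_ne
  rcases signedLE_total (S := S) i b x y with h | h
  · exact key x y hxy hne h
  · exact key y x (hE'.symm hxy) hne.symm h

/-- In the classes of a definable equivalence relation other than equality, there is a
type of pairs which is upward directed, and its sign in one of the orders may be prescribed. -/
theorem Homogeneous.exists_directed_type [Nonempty (Fin n)] (hhom : S.Homogeneous)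
    {E : Γ → Γ → Prop} (hE : S.Definable E) (hE' : Equivalence E) (hE_ne : ∃ x y, E x y ∧ x ≠ y)
    (i₀ : Fin n) (b : Bool) :
    ∃ p : Fin n → Bool, p i₀ = b ∧ ∀ c, ∀ A : Finset Γ, (∀ a ∈ A, E c a) →
      ∃ v, E c v ∧ ∀ a ∈ A, ∀ i, ¬ S.signedLE i (p i) v a := by
  classical
  suffices h : ∀ s : Finset (Fin n), ∃ p : Fin n → Bool, p i₀ = b ∧
      ∀ c, ∀ A : Finset Γ, (∀ a ∈ A, E c a) →
        ∃ v, E c v ∧ ∀ a ∈ A, ∀ i ∈ insert i₀ s, ¬ S.signedLE i (p i) v a by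
    obtain ⟨p, hp, h'⟩ := h Finset.univ
    refine ⟨p, hp, fun c A hA => ?_⟩
    obtain ⟨v, hv, hv'⟩ := h' c A hA
    exact ⟨v, hv, fun a ha i => hv' a ha i (by simp)⟩
  intro s
  induction s using Finset.induction_on with
  | empty =>
    refine ⟨fun _ => b, rfl, fun c A hA => ?_⟩
    obtain ⟨m, hm, hmax⟩ := exists_signedLE_max (S := S) i₀ b (Finset.insert_nonempty c A)
    have hcm : E c m := by
      rcases Finset.mem_insert.1 hm with rfl | hm
      · exact hE'.refl _
      · exact hA m hm
    obtain ⟨v, hv, hv'⟩ := hhom.exists_rel_beyond hE hE' hE_ne i₀ b m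
    refine ⟨v, hE'.trans hcm hv, fun a ha i hi => ?_⟩
    obtain rfl : i = i₀ := by simpa using hi
    exact fun h => hv' (signedLE_trans h (hmax a (Finset.mem_insert_of_mem ha)))
  | insert j s _ ih =>
    obtain ⟨p, hp, ih⟩ := ih
    by_cases hj : j ∈ insert i₀ s
    · refine ⟨p, hp, ?_⟩
      rwa [Finset.insert_comm, Finset.insert_eq_of_mem hj]
    have hji : i₀ ≠ j := fun h => hj (by simp [h])
    have hupdate : ∀ (d : Bool) (v a : Γ), (∀ i ∈ insert i₀ s, ¬ S.signedLE i (p i) v a) →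
        ¬ S.signedLE j d v a → ∀ i ∈ insert i₀ (insert j s),
          ¬ S.signedLE i (Function.update p j d i) v a := by
      intro d v a h₁ h₂ i hi
      rw [Finset.insert_comm] at hi
      rcases Finset.mem_insert.1 hi with rfl | hi
      · simpa using h₂
      · rw [Function.update_of_ne (show i ≠ j from fun h => hj (h ▸ hi))]
        exact h₁ i hi
    by_cases h : ∀ c, ∀ A : Finset Γ, (∀ a ∈ A, E c a) → ∃ v, E c v ∧
        ∀ a ∈ A, (∀ i ∈ insert i₀ s, ¬ S.signedLE i (p i) v a) ∧ ¬ S.signedLE j true v a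
    · refine ⟨Function.update p j true, by rw [Function.update_of_ne hji, hp],
        fun c A hA => ?_⟩
      obtain ⟨v, hv, hv'⟩ := h c A hA
      exact ⟨v, hv, fun a ha => hupdate _ v a (hv' a ha).1 (hv' a ha).2⟩
    · push Not at h
      obtain ⟨c₀, A₀, hA₀, h₀⟩ := h
      have hA₀_ne : A₀.Nonempty := by
        obtain ⟨v, hv, -⟩ := ih c₀ A₀ hA₀
        obtain ⟨a, ha, -⟩ := h₀ v hv
        exact ⟨a, ha⟩
      obtain ⟨a₀, ha₀, hmax⟩ := exists_signedLE_max (S := S) j true hA₀_ne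
      refine ⟨Function.update p j false, by rw [Function.update_of_ne hji, hp],
        fun c A hA => ?_⟩
      obtain ⟨m, hm, hmin⟩ := exists_signedLE_max (S := S) j false (Finset.insert_nonempty c A)
      have hcm : E c m := by
        rcases Finset.mem_insert.1 hm with rfl | hm
        · exact hE'.refl _
        · exact hA m hm
      obtain ⟨σ, hσ, rfl⟩ := hhom.exists_one a₀ m
      obtain ⟨v, hv, hv'⟩ := ih c (A ∪ A₀.image σ) (by
        intro a ha
        rcases Finset.mem_union.1 ha with ha | ha
        · exact hA a ha
        · obtain ⟨a', ha', rfl⟩ := Finset.mem_image.1 ha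
          exact hE'.trans hcm ((hE σ hσ _ _).1 (hE'.trans (hE'.symm (hA₀ a₀ ha₀)) (hA₀ a' ha'))))
      obtain ⟨w, rfl⟩ := σ.surjective v
      have hw : E c₀ w := by
        refine hE'.trans (hA₀ a₀ ha₀) ((hE σ hσ _ _).2 ?_)
        exact hE'.trans (hE'.symm hcm) hv
      obtain ⟨a₁, ha₁, hwa⟩ := h₀ w hw
      have hwa₁ := hwa fun i hi hle => hv' (σ a₁)
        (Finset.mem_union_right _ (Finset.mem_image_of_mem σ ha₁)) i hi
        ((signedLE_definable i (p i) σ hσ _ _).1 hle)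
      have hle : S.le j (σ w) (σ a₀) := (hσ j _ _).1 (S.trans j _ _ _ hwa₁ (hmax a₁ ha₁))
      refine ⟨σ w, hv, fun a ha => ?_⟩
      have hva := hv' a (Finset.mem_union_left _ ha)
      refine hupdate _ _ _ hva fun hle' => ?_
      have hle₁ : S.le j (σ a₀) a := hmin a (Finset.mem_insert_of_mem ha)
      have h_eq : σ w = a := S.antisymm j _ _ (S.trans j _ _ _ hle hle₁) hle'
      exact hva i₀ (Finset.mem_insert_self _ _) (h_eq ▸ signedLE_refl _ _ _)

/-! ### Meet-irreducible relations are convex for two orders -/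

variable (S) in
/-- Equality of the suprema of classes. -/
def SupEq (E : Γ → Γ → Prop) (i : Fin n) (b : Bool) (x y : Γ) : Prop :=
  SupLE (S.signedLE i b) E x y ∧ SupLE (S.signedLE i b) E y x

theorem supLE_trans {E : Γ → Γ → Prop} {i : Fin n} {b : Bool} {x y z : Γ}
    (h₁ : SupLE (S.signedLE i b) E x y) (h₂ : SupLE (S.signedLE i b) E y z) :
    SupLE (S.signedLE i b) E x z := by
  intro x' hx'
  obtain ⟨y', hy', h⟩ := h₁ x' hx'
  obtain ⟨z', hz', h'⟩ := h₂ y' hy'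
  exact ⟨z', hz', signedLE_trans h h'⟩

theorem supLE_of_rel {E : Γ → Γ → Prop} (hE' : Equivalence E) (i : Fin n) (b : Bool) {x y : Γ}
    (h : E x y) : SupLE (S.signedLE i b) E x y :=
  fun x' hx' => ⟨x', hE'.trans (hE'.symm h) hx', signedLE_refl i b x'⟩

theorem supEq_of_rel {E : Γ → Γ → Prop} (hE' : Equivalence E) (i : Fin n) (b : Bool) {x y : Γ}
    (h : E x y) : S.SupEq E i b x y :=
  ⟨supLE_of_rel hE' i b h, supLE_of_rel hE' i b (hE'.symm h)⟩

theorem supEq_definable {E : Γ → Γ → Prop} (hE : S.Definable E) (i : Fin n) (b : Bool) :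
    S.Definable (S.SupEq E i b) :=
  have h := SupLE.definable (signedLE_definable i b) hE
  h.and h.swap

theorem supEq_equivalence {E : Γ → Γ → Prop} (hE' : Equivalence E) (i : Fin n) (b : Bool) :
    Equivalence (S.SupEq E i b) where
  refl x := supEq_of_rel hE' i b (hE'.refl x)
  symm h := ⟨h.2, h.1⟩
  trans h h' := ⟨supLE_trans h.1 h'.1, supLE_trans h'.2 h.2⟩

theorem Homogeneous.convex_of_supEq [Nonempty (Fin n)] (hhom : S.Homogeneous)
    {E : Γ → Γ → Prop} (hE : S.Definable E) (hE' : Equivalence E) {i : Fin n} {b : Bool}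
    (h : ∀ x y, S.SupEq E i b x y → E x y) : S.Convex i E := by
  classical
  let _ : LinearOrder Γ :=
    { le := S.signedLE i b
      le_refl := signedLE_refl i b
      le_trans := fun _ _ _ => signedLE_trans
      le_antisymm := fun _ _ => signedLE_antisymm
      le_total := signedLE_total i b
      toDecidableLE := Classical.decRel _ }
  have key : ∀ x y z, S.signedLE i b x y → S.signedLE i b y z → E x z → E x y :=
    hhom.convex_of_supLE_injective (signedLE_definable i b) hE hE' fun x y h₁ h₂ => h x y ⟨h₁, h₂⟩
  intro x y z hxy hyz hxz
  cases b
  · exact hE'.trans hxz (key z y x hyz hxy (hE'.symm hxz))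
  · exact key x y z hxy hyz hxz

/-- If `E` is convex for at most one of the orders, then classes of `E` are determined by their
endpoints in the other orders. -/
theorem Homogeneous.rel_of_forall_supEq [Nonempty (Fin n)] (hhom : S.Homogeneous)
    {E : Γ → Γ → Prop} (hE : S.Definable E) (hE' : Equivalence E) (hE_ne : ∃ x y, E x y ∧ x ≠ y)
    (i₀ : Fin n) (hconv : ∀ i, S.Convex i E → i = i₀) {x y : Γ}
    (h : ∀ i b, ¬ S.Convex i E → S.SupEq E i b x y) : E x y := by
  classical
  by_contra hxy
  obtain ⟨b, hb⟩ : ∃ b, S.Convex i₀ E → ∀ v, E x v → ¬ S.signedLE i₀ b v y := by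
    by_cases hc : S.Convex i₀ E
    · by_cases hv : ∃ v, E x v ∧ S.le i₀ v y
      · obtain ⟨v, hv, hvy⟩ := hv
        refine ⟨false, fun _ w hw hle => hxy ?_⟩
        have hle : S.le i₀ y w := hle
        exact hE'.trans hv (hc v y w hvy hle (hE'.trans (hE'.symm hv) hw))
      · push Not at hv
        exact ⟨true, fun _ => hv⟩
    · exact ⟨true, fun h => (hc h).elim⟩
  obtain ⟨p, hp, hdir⟩ := hhom.exists_directed_type hE hE' hE_ne i₀ b
  have hbound : ∀ i, ∃ a, E x a ∧ (¬ S.Convex i E → S.signedLE i (p i) y a) := by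
    intro i
    by_cases hc : S.Convex i E
    · exact ⟨x, hE'.refl x, fun h => (h hc).elim⟩
    · obtain ⟨a, ha, hya⟩ := (h i (p i) hc).2 y (hE'.refl y)
      exact ⟨a, ha, fun _ => hya⟩
  choose a ha hya using hbound
  obtain ⟨v, hv, hv'⟩ := hdir x (insert x (Finset.univ.image a)) (by
    intro z hz
    rcases Finset.mem_insert.1 hz with rfl | hz
    · exact hE'.refl _
    · obtain ⟨i, -, rfl⟩ := Finset.mem_image.1 hz
      exact ha i)
  have hyv : ∀ i, ¬ S.signedLE i (p i) v y := by
    intro i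
    by_cases hc : S.Convex i E
    · obtain rfl := hconv i hc
      rw [hp]
      exact hb hc v hv
    · exact fun hle => hv' (a i) (by simp) i (signedLE_trans hle (hya i hc))
  have h_eq := pairType_eq_of_signedLE p (hv' x (by simp)) hyv
  exact hxy (hE'.trans hv (hE'.symm ((hhom.rel_iff hE h_eq).1 hv)))

variable (S) in
/-- Meet-irreducibility in the lattice of definable equivalence relations, for pairs. -/
def IsMeetIrred (R : Γ → Γ → Prop) : Prop :=
  ∀ F G : Γ → Γ → Prop, S.Definable F → Equivalence F →
    S.Definable G → Equivalence G → (∀ x y, R x y ↔ F x y ∧ G x y) →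
    (∀ x y, R x y ↔ F x y) ∨ (∀ x y, R x y ↔ G x y)

theorem IsMeetIrred.exists_of_finset {R : Γ → Γ → Prop} (hR : S.IsMeetIrred R)
    (hR_top : ¬ ∀ x y, R x y) {ι : Type*} (s : Finset ι) (F : ι → Γ → Γ → Prop)
    (hF : ∀ k ∈ s, S.Definable (F k)) (hF' : ∀ k ∈ s, Equivalence (F k))
    (h : ∀ x y, R x y ↔ ∀ k ∈ s, F k x y) : ∃ k ∈ s, ∀ x y, R x y ↔ F k x y := by
  classical
  induction s using Finset.induction_on with
  | empty => exact (hR_top fun x y => (h x y).2 (by simp)).elim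
  | insert j s _ ih =>
    simp only [Finset.forall_mem_insert] at hF hF' h
    rcases hR (F j) (fun x y => ∀ k ∈ s, F k x y) hF.1 hF'.1
      (fun σ hσ x y => forall₂_congr fun k hk => hF.2 k hk σ hσ x y)
      ⟨fun x k hk => (hF'.2 k hk).refl x, fun h' k hk => (hF'.2 k hk).symm (h' k hk),
        fun h₁ h₂ k hk => (hF'.2 k hk).trans (h₁ k hk) (h₂ k hk)⟩ h with h' | h'
    · exact ⟨j, Finset.mem_insert_self _ _, h'⟩
    · obtain ⟨k, hk, hk'⟩ := ih hF.2 hF'.2 h'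
      exact ⟨k, Finset.mem_insert_of_mem hk, hk'⟩

theorem Homogeneous.exists_two_convex [Nonempty (Fin n)] (hhom : S.Homogeneous)
    {E : Γ → Γ → Prop} (hE : S.Definable E) (hE' : Equivalence E) (hE_ne : ∃ x y, E x y ∧ x ≠ y)
    (hE_top : ¬ ∀ x y, E x y) (hirr : S.IsMeetIrred E) :
    ∃ i j, i ≠ j ∧ S.Convex i E ∧ S.Convex j E := by
  classical
  by_contra! hcon
  obtain ⟨i₀, hi₀⟩ : ∃ i₀, ∀ i, S.Convex i E → i = i₀ := by
    by_cases hc : ∃ i, S.Convex i E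
    · obtain ⟨i₀, h₀⟩ := hc
      exact ⟨i₀, fun i hi => by_contra fun hne => hcon i i₀ hne hi h₀⟩
    · push Not at hc
      obtain ⟨i₀⟩ := ‹Nonempty (Fin n)›
      exact ⟨i₀, fun i hi => (hc i hi).elim⟩
  obtain ⟨⟨i, b⟩, hi, h⟩ := hirr.exists_of_finset hE_top
    (Finset.univ.filter fun k : Fin n × Bool => ¬ S.Convex k.1 E)
    (fun k => S.SupEq E k.1 k.2) (fun k _ => supEq_definable hE k.1 k.2)
    (fun k _ => supEq_equivalence hE' k.1 k.2) (fun x y =>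
      ⟨fun hxy k _ => supEq_of_rel hE' k.1 k.2 hxy, fun hxy =>
        hhom.rel_of_forall_supEq hE hE' hE_ne i₀ hi₀ fun i b hc => hxy (i, b) (by simpa using hc)⟩)
  exact (Finset.mem_filter.1 hi).2 (hhom.convex_of_supEq hE hE' fun x y => (h x y).2)

end PermStruct

/-- In a homogeneous `n`-dimensional permutation structure, if `Λ₀` is the set of
meet-irreducible ∅-definable equivalence relations other than equality and the trivial
relation, and `ℓ` is the least cardinality of a family of chains of ∅-definable equivalence
relations (under refinement) whose union contains `Λ₀`, then `2ℓ ≤ n`. -/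
theorem two_mul_chain_cover_le_dim
    {n : ℕ} {Γ : Type*} [Countable Γ] [Infinite Γ] (S : PermStruct n Γ)
    (hhom : S.Homogeneous)
    (Λ₀ : Set (Γ → Γ → Prop))
    (hΛ₀ : ∀ R : Γ → Γ → Prop, R ∈ Λ₀ ↔
      (S.Definable R ∧ Equivalence R ∧
        ¬ (∀ x y, R x y ↔ x = y) ∧ ¬ (∀ x y, R x y) ∧
        (∀ F G : Γ → Γ → Prop, S.Definable F → Equivalence F →
          S.Definable G → Equivalence G → (∀ x y, R x y ↔ F x y ∧ G x y) →
          (∀ x y, R x y ↔ F x y) ∨ (∀ x y, R x y ↔ G x y))))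
    (ℓ : ℕ)
    (hleast : IsLeast {k : ℕ | ∃ 𝒞 : Fin k → Set (Γ → Γ → Prop),
      (∀ i, (∀ R ∈ 𝒞 i, S.Definable R ∧ Equivalence R) ∧
        IsChain (fun R R' : Γ → Γ → Prop => ∀ x y, R x y → R' x y) (𝒞 i)) ∧
      Λ₀ ⊆ ⋃ i, 𝒞 i} ℓ) :
    2 * ℓ ≤ n := by
  classical
  rcases isEmpty_or_nonempty (Fin n) with hn | hn
  · have h_empty : Λ₀ ⊆ ∅ := by
      intro R hR
      obtain ⟨hdef, heq, hbot, htop, -⟩ := (hΛ₀ R).1 hR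
      refine (htop fun u v => ?_).elim
      by_cases huv : u = v
      · exact huv ▸ heq.refl u
      obtain ⟨x, y, hxy, hne⟩ : ∃ x y, R x y ∧ x ≠ y := by
        by_contra! hcon
        exact hbot fun x y => ⟨hcon x y, fun h => h ▸ heq.refl x⟩
      obtain ⟨σ, hσ, h⟩ := hhom {x, y} (fun z => if z = x then u else v)
        (by simp [Set.InjOn, hne, hne.symm, huv, Ne.symm huv]) (fun i => hn.elim i)
      have h_x := h x (by simp)
      have h_y := h y (by simp)
      simp only [if_true, hne.symm, if_false] at h_x h_y
      rw [← h_x, ← h_y]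
      exact (hdef σ hσ x y).1 hxy
    have := hleast.2 (show 0 ∈ _ from ⟨fun _ => ∅, fun i => i.elim0, fun R hR => (h_empty hR).elim⟩)
    omega
  have hconv : ∀ R ∈ Λ₀, ∃ i j, i ≠ j ∧ S.Convex i R ∧ S.Convex j R := by
    intro R hR
    obtain ⟨hdef, heq, hbot, htop, hirr⟩ := (hΛ₀ R).1 hR
    refine hhom.exists_two_convex hdef heq ?_ htop hirr
    by_contra! hcon
    exact hbot fun x y => ⟨hcon x y, fun h => h ▸ heq.refl x⟩
  have hfin : Λ₀.Finite := hhom.finite_definable.subset fun R hR => ((hΛ₀ R).1 hR).1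
  obtain ⟨k, ⟨A, hA, hA_anti, hAk⟩, f, hfk, hf⟩ := hfin.toFinset.exists_antichain_and_chain_cover
  have hℓk : ℓ ≤ k := by
    refine hleast.2 ⟨fun c => {R | R ∈ Λ₀ ∧ f R = c}, fun c => ⟨?_, ?_⟩, ?_⟩
    · rintro R ⟨hR, -⟩
      exact ⟨((hΛ₀ R).1 hR).1, ((hΛ₀ R).1 hR).2.1⟩
    · rintro R ⟨hR, hRc⟩ R' ⟨hR', hRc'⟩ -
      exact hf R (by simpa using hR) R' (by simpa using hR') (hRc.trans hRc'.symm)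
    · intro R hR
      exact Set.mem_iUnion.2 ⟨⟨f R, hfk R (by simpa using hR)⟩, hR, rfl⟩
  have hAΛ : ∀ R ∈ A, R ∈ Λ₀ := fun R hR => by simpa using hA hR
  have hsum : ∑ R ∈ A, (Finset.univ.filter fun i => S.Convex i R).card ≤ n := by
    rw [← Finset.card_biUnion]
    · simpa using Finset.card_le_univ (A.biUnion fun R => Finset.univ.filter fun i => S.Convex i R)
    · intro R hR R' hR' hne
      refine Finset.disjoint_left.2 fun i hi hi' => ?_
      obtain ⟨hd, he, -⟩ := (hΛ₀ R).1 (hAΛ R hR)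
      obtain ⟨hd', he', -⟩ := (hΛ₀ R').1 (hAΛ R' hR')
      rcases hhom.le_or_le_of_convex hd he (Finset.mem_filter.1 hi).2 hd' he'
        (Finset.mem_filter.1 hi').2 with h | h
      · exact hA_anti hR hR' hne h
      · exact hA_anti hR' hR hne.symm h
  have htwo : A.card * 2 ≤ ∑ R ∈ A, (Finset.univ.filter fun i => S.Convex i R).card := by
    refine Finset.card_nsmul_le_sum A _ 2 fun R hR => ?_
    obtain ⟨i, j, hij, hi, hj⟩ := hconv R (hAΛ R hR)
    exact Finset.one_lt_card.2 ⟨i, by simpa using hi, j, by simpa using hj, hij⟩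
  omega
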